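/- Let P ∈ F_q[θ] be a monic irreducible polynomial. Let M = F_q(t) ⊗_{F_q} (F_q[θ]/(P)), a finite-dimensional F_q(t)-vector space, let τ: M → M be the F_q(t)-linear map with τ(c ⊗ x) = c ⊗ x^q, and let Θ: M → M be the F_q(t)-linear map Θ(m) = (1 ⊗ θ̄)·m + ((t ⊗ 1) − (1 ⊗ θ̄))·τ(m), where θ̄ denotes the class of θ in F_q[θ]/(P) and the products are taken in the ring M. Then M, regarded as a module over the polynomial ring F_q(t)[X] with X acting as Θ, is isomorphic to F_q(t)[X]/(P(X) − P(t)), where P(X) and P(t) denote P with θ replaced by X and by t respectively. -/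

import Mathlib

/-!
Let `P ∈ Fq[θ]` be monic irreducible, `M = Fq(t) ⊗_{Fq} Fq[θ]/(P)`, `τ : M → M` the
`Fq(t)`-linear map with `τ(c ⊗ x) = c ⊗ x^q`, and `Θ(m) = (1 ⊗ θ̄)·m + ((t⊗1) - (1⊗θ̄))·τ(m)`.
Then `M`, as a module over `Fq(t)[X]` with `X` acting as `Θ`, is isomorphic to
`Fq(t)[X]/(P(X) - P(t))`.
-/

noncomputable section

open Polynomial

variable (Fq : Type) [Field Fq] [Fintype Fq]

/-- The residue ring `Fq[θ]/(P)`. -/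
abbrev ResRing (P : Polynomial Fq) := Polynomial Fq ⧸ Ideal.span {P}

/-- `(x + y)^{q} = x^{q} + y^{q}` in any commutative `Fq`-algebra. -/
theorem add_pow_card (R : Type*) [CommRing R] [Algebra Fq R] (x y : R) :
    (x + y) ^ Fintype.card Fq = x ^ Fintype.card Fq + y ^ Fintype.card Fq := by
  rcases subsingleton_or_nontrivial R with h | h
  · exact Subsingleton.elim _ _
  · obtain ⟨n, hp, hcard⟩ := FiniteField.card Fq (ringChar Fq)
    haveI : Fact (Nat.Prime (ringChar Fq)) := ⟨hp⟩
    haveI : CharP R (ringChar Fq) :=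
      charP_of_injective_ringHom (algebraMap Fq R).injective (ringChar Fq)
    rw [hcard]
    exact add_pow_char_pow x y (ringChar Fq) n

/-- The `q`-power Frobenius on `Fq[θ]/(P)`, as an `Fq`-linear map. -/
def frobRes (P : Polynomial Fq) : ResRing Fq P →ₗ[Fq] ResRing Fq P where
  toFun x := x ^ Fintype.card Fq
  map_add' x y := add_pow_card Fq _ x y
  map_smul' c x := by
    simp only [RingHom.id_apply]
    rw [_root_.smul_pow, FiniteField.pow_card]

/-- `M = Fq(t) ⊗_{Fq} Fq[θ]/(P)`, an `Fq(t)`-vector space and a commutative ring. -/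
abbrev Mt (P : Polynomial Fq) := TensorProduct Fq (RatFunc Fq) (ResRing Fq P)

/-- `τ : M → M`, the `Fq(t)`-linear map `c ⊗ x ↦ c ⊗ x^q`. -/
def tauM (P : Polynomial Fq) : Mt Fq P →ₗ[RatFunc Fq] Mt Fq P :=
  LinearMap.baseChange (RatFunc Fq) (frobRes Fq P)

/-- `1 ⊗ θ̄ ∈ M`. -/
def thetaBar (P : Polynomial Fq) : Mt Fq P :=
  Algebra.TensorProduct.includeRight (Ideal.Quotient.mk (Ideal.span {P}) Polynomial.X)

/-- `t ⊗ 1 ∈ M`. -/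
def tM (P : Polynomial Fq) : Mt Fq P :=
  Algebra.TensorProduct.includeLeft (S := Fq) (RatFunc.X)

/-- `Θ : M → M`, `Θ(m) = (1⊗θ̄)·m + ((t⊗1) - (1⊗θ̄))·τ(m)`, an `Fq(t)`-linear map. -/
def ThetaM (P : Polynomial Fq) : Mt Fq P →ₗ[RatFunc Fq] Mt Fq P :=
  LinearMap.mulLeft (RatFunc Fq) (thetaBar Fq P) +
    (LinearMap.mulLeft (RatFunc Fq) (tM Fq P - thetaBar Fq P)).comp (tauM Fq P)

section Twist

variable {K A : Type*} [Field K] [CommRing A] [Algebra K A]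

/-- The twist `m ↦ θ m + (t - θ) τ(m)` of multiplication by `θ`. -/
def twistedMul (τ : A →ₐ[K] A) (θ : A) (t : K) : Module.End K A :=
  LinearMap.mulLeft K θ +
    (LinearMap.mulLeft K (algebraMap K A t - θ)).comp τ.toLinearMap

/-- Precomposition with `φ`, as an `A`-linear endomorphism of `End_K(A)`. -/
def precomp (φ : Module.End K A) : Module.End A (Module.End K A) where
  toFun f := f ∘ₗ φ
  map_add' _ _ := rfl
  map_smul' _ _ := rfl

theorem aeval_precomp_map_one (φ : Module.End K A) (f : K[X]) :
    aeval (precomp φ) (f.map (algebraMap K A)) 1 = aeval φ f := by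
  induction f using Polynomial.induction_on' with
  | add p q hp hq => rw [Polynomial.map_add, map_add, LinearMap.add_apply, hp, hq, map_add]
  | monomial n a =>
    have hpow : ∀ n, (precomp φ ^ n) 1 = φ ^ n := by
      intro n
      induction n with
      | zero => rfl
      | succ n ih => rw [pow_succ', Module.End.mul_apply, ih, pow_succ]; rfl
    rw [Polynomial.map_monomial, aeval_monomial, aeval_monomial, Module.End.mul_apply, hpow]
    ext x
    simp [Module.algebraMap_end_apply]

theorem aeval_precomp_twistedMul_prod (τ : A →ₐ[K] A) (θ : A) (t : K) (n : ℕ) :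
    aeval (precomp (twistedMul τ θ t)) (∏ i ∈ Finset.range n, (X - C ((τ ^ i) θ))) 1 =
      (∏ i ∈ Finset.range n, (algebraMap K A t - (τ ^ i) θ)) • (τ ^ n).toLinearMap := by
  induction n with
  | zero => ext x; simp
  | succ n ih =>
    rw [Finset.prod_range_succ, mul_comm, map_mul, Module.End.mul_apply, ih, map_smul,
      Finset.prod_range_succ, mul_smul]
    congr 1
    ext x
    have ht : (τ ^ n) (algebraMap K A t) = algebraMap K A t := AlgHom.commutes _ _
    simp only [precomp, twistedMul, map_sub, aeval_X, aeval_C, LinearMap.sub_apply,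
      LinearMap.coe_mk, AddHom.coe_mk, Module.algebraMap_end_apply, LinearMap.comp_apply,
      LinearMap.add_apply, LinearMap.mulLeft_apply, LinearMap.smul_apply, map_add, map_mul,
      AlgHom.toLinearMap_apply, smul_eq_mul, ht, pow_succ, AlgHom.mul_apply]
    ring

theorem eq_sum_newton (a : ℕ → A) (n : ℕ) (f : A[X]) (hf : f.degree < n) :
    ∃ c : ℕ → A, f = ∑ j ∈ Finset.range n, C (c j) * ∏ i ∈ Finset.range j, (X - C (a i)) := by
  nontriviality A
  induction n generalizing f with
  | zero => exact ⟨0, by simpa using hf⟩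
  | succ n ih =>
    have hm : (∏ i ∈ Finset.range n, (X - C (a i))).Monic :=
      monic_prod_of_monic _ _ fun i _ => monic_X_sub_C _
    have hd : (∏ i ∈ Finset.range n, (X - C (a i))).natDegree = n := by
      rw [natDegree_prod_of_monic _ _ fun i _ => monic_X_sub_C _]; simp
    obtain ⟨c, hc⟩ := ih (f - C (f.coeff n) * ∏ i ∈ Finset.range n, (X - C (a i))) (by
      rw [degree_lt_iff_coeff_zero] at hf ⊢
      intro m hnm
      rcases hnm.eq_or_lt with rfl | h
      · have := hm.coeff_natDegree
        rw [hd] at this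
        simp [this]
      · rw [coeff_sub, hf m h, coeff_C_mul,
          coeff_eq_zero_of_natDegree_lt (hd.trans_lt h), mul_zero, sub_zero])
    refine ⟨Function.update c n (f.coeff n), ?_⟩
    rw [Finset.sum_range_succ, Function.update_self, ← sub_eq_iff_eq_add, hc]
    refine Finset.sum_congr rfl fun j hj => ?_
    rw [Function.update_of_ne (Finset.mem_range.mp hj).ne]

theorem aeval_twistedMul {d : ℕ} {Q : K[X]} {τ : A →ₐ[K] A} {θ : A}
    (hτ : τ ^ d = 1)
    (hQ : Q.map (algebraMap K A) = ∏ i ∈ Finset.range d, (X - C ((τ ^ i) θ))) (t : K) :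
    aeval (twistedMul τ θ t) Q = algebraMap K _ (Q.eval t) := by
  have h := congrArg (eval (algebraMap K A t)) hQ
  rw [eval_map_algebraMap, aeval_algebraMap_apply, coe_aeval_eq_eval, eval_prod] at h
  simp only [eval_sub, eval_X, eval_C] at h
  rw [← aeval_precomp_map_one, hQ, aeval_precomp_twistedMul_prod, hτ, ← h]
  ext x
  simp [Module.algebraMap_end_apply, Algebra.smul_def]

theorem eq_zero_of_aeval_twistedMul [Nontrivial A] {d : ℕ} {Q : K[X]} {τ : A →ₐ[K] A} {θ : A}
    (hQ : Q.map (algebraMap K A) = ∏ i ∈ Finset.range d, (X - C ((τ ^ i) θ)))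
    (hli : LinearIndependent A fun j : Fin d => (τ ^ (j : ℕ)).toLinearMap)
    {t : K} (ht : Q.eval t ≠ 0) {f : K[X]} (hf : f.degree < d)
    (h0 : aeval (twistedMul τ θ t) f = 0) : f = 0 := by
  have h := congrArg (eval (algebraMap K A t)) hQ
  rw [eval_map_algebraMap, aeval_algebraMap_apply, coe_aeval_eq_eval, eval_prod] at h
  simp only [eval_sub, eval_X, eval_C] at h
  obtain ⟨c, hc⟩ := eq_sum_newton (fun i => (τ ^ i) θ) d (f.map (algebraMap K A))
    (by rwa [degree_map])
  have hunit : ∀ j < d, IsUnit (∏ i ∈ Finset.range j, (algebraMap K A t - (τ ^ i) θ)) := by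
    intro j hj
    refine isUnit_of_dvd_unit ?_ (h ▸ (Ne.isUnit ht).map (algebraMap K A))
    exact Finset.prod_dvd_prod_of_subset _ _ _ (Finset.range_mono hj.le)
  rw [← aeval_precomp_map_one, hc, map_sum, LinearMap.sum_apply] at h0
  simp only [map_mul, Module.End.mul_apply, aeval_precomp_twistedMul_prod, aeval_C,
    Module.algebraMap_end_apply, smul_smul] at h0
  rw [← Fin.sum_univ_eq_sum_range (fun j => (c j * ∏ i ∈ Finset.range j,
    (algebraMap K A t - (τ ^ i) θ)) • (τ ^ j).toLinearMap)] at h0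
  have h1 := Fintype.linearIndependent_iff.mp hli _ h0
  have hmap : f.map (algebraMap K A) = 0 := by
    rw [hc]
    refine Finset.sum_eq_zero fun j hj => ?_
    have hj := Finset.mem_range.mp hj
    rw [((hunit j hj).mul_left_eq_zero).mp (h1 ⟨j, hj⟩)]
    simp
  exact (Polynomial.map_eq_zero _).mp hmap

theorem minpoly_twistedMul [Nontrivial A] {d : ℕ} (hd : d ≠ 0) {Q : K[X]}
    {τ : A →ₐ[K] A} {θ : A} (hτ : τ ^ d = 1)
    (hQ : Q.map (algebraMap K A) = ∏ i ∈ Finset.range d, (X - C ((τ ^ i) θ)))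
    (hli : LinearIndependent A fun j : Fin d => (τ ^ (j : ℕ)).toLinearMap)
    {t : K} (ht : Q.eval t ≠ 0) (hQm : Q.Monic) (hQd : Q.natDegree = d) :
    minpoly K (twistedMul τ θ t) = Q - C (Q.eval t) := by
  have hdeg : (C (Q.eval t)).degree < Q.degree :=
    degree_C_le.trans_lt (natDegree_pos_iff_degree_pos.mp (by omega))
  symm
  refine minpoly.unique' K _ (hQm.sub_of_left hdeg) ?_ fun f hf => ?_
  · rw [map_sub, aeval_twistedMul hτ hQ, aeval_C, sub_self]
  · by_contra! h
    refine h.1 (eq_zero_of_aeval_twistedMul hQ hli ht ?_ h.2)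
    rwa [degree_sub_eq_left_of_degree_lt hdeg, degree_eq_natDegree hQm.ne_zero, hQd] at hf

/-- If the minimal polynomial of an endomorphism has degree the dimension of the space, the
endomorphism has a cyclic vector. -/
theorem nonempty_aeval_equiv_of_finrank_eq {V : Type*} [AddCommGroup V] [Module K V]
    [Module.Finite K V] (φ : Module.End K V)
    (h : Module.finrank K V = (minpoly K φ).natDegree) :
    Nonempty (Module.AEval' φ ≃ₗ[K[X]] (K[X] ⧸ Ideal.span {minpoly K φ})) := by
  obtain ⟨x, hx⟩ := Module.exists_ker_toSpanSingleton_eq_annihilator K[X] (Module.AEval' φ)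
  rw [← span_minpoly_eq_annihilator] at hx
  rw [← hx]
  let g := LinearMap.ker (LinearMap.toSpanSingleton K[X] (Module.AEval' φ) x) |>.liftQ
    (LinearMap.toSpanSingleton K[X] (Module.AEval' φ) x) le_rfl
  have hinj : Function.Injective g :=
    LinearMap.ker_eq_bot.mp (Submodule.ker_liftQ_eq_bot' _ _ rfl)
  have hfin : Module.finrank K (K[X] ⧸ LinearMap.ker
      (LinearMap.toSpanSingleton K[X] (Module.AEval' φ) x)) =
      Module.finrank K (Module.AEval' φ) := by
    rw [hx, ← (Module.AEval'.of φ).finrank_eq, h]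
    exact finrank_quotient_span_eq_natDegree
  have hsurj : Function.Surjective g := by
    have : Module.Finite K (K[X] ⧸ LinearMap.ker
      (LinearMap.toSpanSingleton K[X] (Module.AEval' φ) x)) :=
      Module.Finite.of_injective (g.restrictScalars K) hinj
    exact (LinearMap.injective_iff_surjective_of_finrank_eq_finrank
      (f := g.restrictScalars K) hfin).mp hinj
  exact ⟨(LinearEquiv.ofBijective g ⟨hinj, hsurj⟩).symm⟩

end Twist

section BaseChange

open TensorProduct

variable {k K L : Type*} [Field k] [Field K] [Algebra k K] [Field L] [Algebra k L]

/-- The `K`-linear extension of an endomorphism of `L` to `K ⊗ L`. -/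
def extendScalars (K : Type*) [Field K] [Algebra k K] (σ : L →ₐ[k] L) :
    K ⊗[k] L →ₐ[K] K ⊗[k] L :=
  Algebra.TensorProduct.map (AlgHom.id K K) σ

theorem extendScalars_pow_tmul (σ : L →ₐ[k] L) (n : ℕ) (c : K) (x : L) :
    (extendScalars K σ ^ n) (c ⊗ₜ x) = c ⊗ₜ (σ ^ n) x := by
  induction n with
  | zero => rfl
  | succ n ih => rw [pow_succ', AlgHom.mul_apply, ih, pow_succ', AlgHom.mul_apply]; rfl

theorem extendScalars_pow_eq_one {σ : L →ₐ[k] L} {n : ℕ} (h : σ ^ n = 1) :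
    extendScalars K σ ^ n = 1 := by
  ext x
  exact (extendScalars_pow_tmul σ n 1 x).trans (by rw [h]; rfl)

theorem equivFinsuppOfBasisLeft_mul_one_tmul {ι : Type*} [DecidableEq ι]
    (b : Module.Basis ι k K) (m : K ⊗[k] L) (x : L) (i : ι) :
    TensorProduct.equivFinsuppOfBasisLeft b (m * 1 ⊗ₜ x) i =
      TensorProduct.equivFinsuppOfBasisLeft b m i * x := by
  induction m with
  | zero => simp
  | add m n hm hn => simp [add_mul, hm, hn]
  | tmul c y => simp

theorem linearIndependent_extendScalars_pow {σ : L →ₐ[k] L} {d : ℕ}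
    (hσ : Function.Injective fun j : Fin d => σ ^ (j : ℕ)) :
    LinearIndependent (K ⊗[k] L)
      fun j : Fin d => (extendScalars K σ ^ (j : ℕ)).toLinearMap := by
  classical
  have hL : LinearIndependent L fun j : Fin d => (σ ^ (j : ℕ)).toLinearMap :=
    (linearIndependent_algHom_toLinearMap k L L).comp _ hσ
  rw [Fintype.linearIndependent_iff] at hL ⊢
  intro g hg j
  let b := Module.Basis.ofVectorSpace k K
  refine (TensorProduct.equivFinsuppOfBasisLeft b).map_eq_zero_iff.mp (Finsupp.ext fun i => ?_)
  refine hL (fun j => TensorProduct.equivFinsuppOfBasisLeft b (g j) i) ?_ j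
  ext x
  have h := congrArg (fun m => TensorProduct.equivFinsuppOfBasisLeft b m i)
    (LinearMap.congr_fun hg (1 ⊗ₜ x))
  simp only [LinearMap.sum_apply, LinearMap.smul_apply, AlgHom.toLinearMap_apply,
    extendScalars_pow_tmul, smul_eq_mul, map_sum, Finsupp.coe_finsetSum, Finset.sum_apply,
    equivFinsuppOfBasisLeft_mul_one_tmul, LinearMap.zero_apply, map_zero,
    Finsupp.coe_zero, Pi.zero_apply] at h
  simpa [LinearMap.sum_apply] using h

/-- A monic polynomial whose degree is the number of distinct conjugates of one of its roots
splits as the product over those conjugates. -/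
theorem map_eq_prod_X_sub_C_pow {σ : L →ₐ[k] L} {P : k[X]} (hm : P.Monic)
    {a : L} (ha : aeval a P = 0)
    (hinj : Set.InjOn (fun j => (σ ^ j) a) (Finset.range P.natDegree)) :
    P.map (algebraMap k L) = ∏ i ∈ Finset.range P.natDegree, (X - C ((σ ^ i) a)) := by
  refine eq_of_monic_of_dvd_of_natDegree_le
    (monic_prod_of_monic _ _ fun i _ => monic_X_sub_C ((σ ^ i) a)) (hm.map _) ?_ ?_
  · refine Finset.prod_dvd_of_coprime ?_ fun i _ => ?_
    · intro i hi j hj hij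
      exact isCoprime_X_sub_C_of_isUnit_sub
        (sub_ne_zero.mpr fun h => hij (hinj hi hj h)).isUnit
    · rw [dvd_iff_isRoot, IsRoot, eval_map_algebraMap, aeval_algHom_apply, ha, map_zero]
  · rw [natDegree_map, natDegree_prod_of_monic _ _ fun i _ => monic_X_sub_C _]
    simp

end BaseChange

theorem aeval_module_iso_of_pellarin_twist
    (P : Polynomial Fq) (hP : Irreducible P) (hmonic : P.Monic) :
    Nonempty
      (Module.AEval' (ThetaM Fq P) ≃ₗ[Polynomial (RatFunc Fq)]
        (Polynomial (RatFunc Fq) ⧸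
          Ideal.span {P.map (algebraMap Fq (RatFunc Fq)) -
            Polynomial.C (Polynomial.aeval (RatFunc.X : RatFunc Fq) P)})) := by
  have := PrincipalIdealRing.isMaximal_of_irreducible hP
  let : Field (ResRing Fq P) := Ideal.Quotient.field _
  have hrank : Module.finrank Fq (ResRing Fq P) = P.natDegree :=
    finrank_quotient_span_eq_natDegree
  have hdeg : 0 < P.natDegree := hP.natDegree_pos
  have : Module.Finite Fq (ResRing Fq P) :=
    Module.finite_of_finrank_pos (hrank ▸ hdeg)
  have : Finite (ResRing Fq P) := Module.finite_of_finite Fq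
  let σ := FiniteField.frobeniusAlgHom Fq (ResRing Fq P)
  let a : ResRing Fq P := Ideal.Quotient.mk (Ideal.span {P}) X
  have ha : ∀ f : Fq[X], aeval a f = Ideal.Quotient.mk (Ideal.span {P}) f := fun f =>
    AdjoinRoot.aeval_eq (f := P) f
  have hinj : Set.InjOn (fun j => σ ^ j) (Finset.range P.natDegree) := by
    rw [← hrank, ← FiniteField.orderOf_frobeniusAlgHom, Finset.coe_range]
    exact pow_injOn_Iio_orderOf
  have hroots : Set.InjOn (fun j => (σ ^ j) a) (Finset.range P.natDegree) :=
    fun i hi j hj hij => hinj hi hj <| AlgHom.ext fun x => by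
      obtain ⟨f, rfl⟩ := Ideal.Quotient.mk_surjective x
      rw [← ha, ← aeval_algHom_apply, ← aeval_algHom_apply]
      exact congrArg (fun y => aeval y f) hij
  have hσ : σ ^ P.natDegree = 1 := by
    rw [← hrank, ← FiniteField.orderOf_frobeniusAlgHom]
    exact pow_orderOf_eq_one _
  have hprod := map_eq_prod_X_sub_C_pow (σ := σ) (a := a) hmonic
    (by rw [ha, Ideal.Quotient.eq_zero_iff_mem]; exact Ideal.mem_span_singleton_self P) hroots
  have hprod' : (P.map (algebraMap Fq (RatFunc Fq))).map (algebraMap (RatFunc Fq) (Mt Fq P)) =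
      ∏ i ∈ Finset.range P.natDegree,
        (X - C ((extendScalars (RatFunc Fq) σ ^ i) (thetaBar Fq P))) := by
    have h := congrArg (Polynomial.map
      (Algebra.TensorProduct.includeRight : ResRing Fq P →ₐ[Fq] Mt Fq P).toRingHom) hprod
    rw [Polynomial.map_map, Polynomial.map_prod] at h
    rw [Polynomial.map_map, ← IsScalarTower.algebraMap_eq]
    have hc := (Algebra.TensorProduct.includeRight :
      ResRing Fq P →ₐ[Fq] Mt Fq P).comp_algebraMap
    refine (congrArg (fun r => P.map r) hc.symm).trans (h.trans ?_)
    refine Finset.prod_congr rfl fun i _ => ?_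
    rw [Polynomial.map_sub, map_X, map_C]
    exact congrArg (fun y => X - C y)
      (extendScalars_pow_tmul (K := RatFunc Fq) σ i 1 a).symm
  have hΘ : ThetaM Fq P =
      twistedMul (extendScalars (RatFunc Fq) σ) (thetaBar Fq P) RatFunc.X := rfl
  have ht : (P.map (algebraMap Fq (RatFunc Fq))).eval RatFunc.X = aeval RatFunc.X P :=
    eval_map_algebraMap _ _
  have ht0 : aeval (RatFunc.X : RatFunc Fq) P ≠ 0 := by
    rw [← RatFunc.algebraMap_X, aeval_algebraMap_apply, aeval_X_left_apply]
    exact (map_ne_zero_iff _ (RatFunc.algebraMap_injective Fq)).mpr hmonic.ne_zero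
  have hmin := minpoly_twistedMul hdeg.ne' (extendScalars_pow_eq_one hσ) hprod'
    (linearIndependent_extendScalars_pow fun i j hij =>
      Fin.ext (hinj (by simp) (by simp) hij)) (ht ▸ ht0) (hmonic.map _) (natDegree_map _)
  rw [ht, ← hΘ] at hmin
  rw [← hmin]
  refine nonempty_aeval_equiv_of_finrank_eq _ ?_
  rw [hmin, natDegree_sub_C, natDegree_map, Module.finrank_baseChange, hrank]

end
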